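/- For every choice of the real parameters ζ₁₁, ζ₂₂, ζ₃₃, ζ₁₂, ζ₁₃, ζ₂₃, ξ₁₁, ξ₂₂, ξ₃₃, ξ₁₂, ξ₁₃, ξ₂₃ and all a, b, i ∈ {1,...,4}, define on ℝ⁴∖{0} the function (L_{ab})_i(x) = ∂_i( h_{ab}(x) + x^a·∑_{j=1}^4 ∂_j h_{bj}(x) ) + δ_{ib}·∑_{j=1}^4 ∂_j h_{ja}(x) + ∂_a h_{ib}(x) − δ_{ia}·∑_{j=1}^4 ∂_j h_{jb}(x) − ∂_b h_{ia}(x). Then the function μ̃(x) := |x|²·(L_{ab})_i(x)/12 satisfies ∑_{l=1}^4 ∂_l²( μ̃ )(x) = −(L_{ab})_i(x) for all x ∈ ℝ⁴∖{0}; equivalently, for the geometer's Laplacian Δ = −∑_{l=1}^4 ∂_l², Δμ̃ = (L_{ab})_i. -/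

import Mathlib

open scoped BigOperators

noncomputable section

/-- Partial derivative in the `i`-th coordinate direction. -/
def pd {n : ℕ} (i : Fin n) (f : (Fin n → ℝ) → ℝ) : (Fin n → ℝ) → ℝ :=
  fun x => fderiv ℝ f x (Pi.single i 1)

/-- The complex structure `I₁` on `ℝ⁴`. -/
def I1 : Matrix (Fin 4) (Fin 4) ℝ :=
  !![0, -1, 0, 0; 1, 0, 0, 0; 0, 0, 0, -1; 0, 0, 1, 0]

/-- The complex structure `I₂` on `ℝ⁴`. -/
def I2 : Matrix (Fin 4) (Fin 4) ℝ :=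
  !![0, 0, -1, 0; 0, 0, 0, 1; 1, 0, 0, 0; 0, -1, 0, 0]

/-- The complex structure `I₃ = I₁ I₂` on `ℝ⁴`. -/
def I3 : Matrix (Fin 4) (Fin 4) ℝ := I1 * I2

/-- `α_J(x) = Jᵀ x`. -/
def alphaVec (J : Matrix (Fin 4) (Fin 4) ℝ) (x : Fin 4 → ℝ) : Fin 4 → ℝ :=
  Matrix.mulVec (Matrix.transpose J) x

/-- The outer product `A_{JK}(x) = α_J(x) · α_K(x)ᵀ`. -/
def Amat (J K : Matrix (Fin 4) (Fin 4) ℝ) (x : Fin 4 → ℝ) : Matrix (Fin 4) (Fin 4) ℝ :=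
  Matrix.vecMulVec (alphaVec J x) (alphaVec K x)

/-- The leading term `h⁺` of the expansion of an ALE metric,
`h⁺(x) = −(2/(3 r⁶)) · [ζ₁₁(2A₁₁−A₂₂−A₃₃) + ζ₂₂(2A₂₂−A₁₁−A₃₃) + ζ₃₃(2A₃₃−A₁₁−A₂₂)
          + ζ₁₂(A₁₂+A₂₁) + ζ₁₃(A₁₃+A₃₁) + ζ₂₃(A₂₃+A₃₂)]`. -/
def hplus (ζ11 ζ22 ζ33 ζ12 ζ13 ζ23 : ℝ) (x : Fin 4 → ℝ) : Matrix (Fin 4) (Fin 4) ℝ :=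
  (-(2 / (3 * (∑ i, x i ^ 2) ^ 3))) •
    (ζ11 • ((2 : ℝ) • Amat I1 I1 x - Amat I2 I2 x - Amat I3 I3 x) +
     ζ22 • ((2 : ℝ) • Amat I2 I2 x - Amat I1 I1 x - Amat I3 I3 x) +
     ζ33 • ((2 : ℝ) • Amat I3 I3 x - Amat I1 I1 x - Amat I2 I2 x) +
     ζ12 • (Amat I1 I2 x + Amat I2 I1 x) +
     ζ13 • (Amat I1 I3 x + Amat I3 I1 x) +
     ζ23 • (Amat I2 I3 x + Amat I3 I2 x))

/-- The reflection `ℛ = diag(1,−1,−1,−1)`. -/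
def Rrefl : Matrix (Fin 4) (Fin 4) ℝ := Matrix.diagonal ![1, -1, -1, -1]

/-- `h⁻(x) = ℛ · h⁺_ξ(ℛ x) · ℛ`. -/
def hminus (ξ11 ξ22 ξ33 ξ12 ξ13 ξ23 : ℝ) (x : Fin 4 → ℝ) : Matrix (Fin 4) (Fin 4) ℝ :=
  Rrefl * hplus ξ11 ξ22 ξ33 ξ12 ξ13 ξ23 (Matrix.mulVec Rrefl x) * Rrefl

/-- `h = h⁺ + h⁻`. -/
def hfull (ζ11 ζ22 ζ33 ζ12 ζ13 ζ23 ξ11 ξ22 ξ33 ξ12 ξ13 ξ23 : ℝ)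
    (x : Fin 4 → ℝ) : Matrix (Fin 4) (Fin 4) ℝ :=
  hplus ζ11 ζ22 ζ33 ζ12 ζ13 ζ23 x + hminus ξ11 ξ22 ξ33 ξ12 ξ13 ξ23 x

/-- The `i`-th component of the 1-form `L_{ab}`, the leading term of the Laplacian of the
1-form `x^a dx^b` with respect to the metric `g₀ + h`:
`(L_{ab})_i = ∂_i(h_{ab} + x^a ∑_j ∂_j h_{bj}) + δ_{ib} ∑_j ∂_j h_{ja} + ∂_a h_{ib}
              − δ_{ia} ∑_j ∂_j h_{jb} − ∂_b h_{ia}`. -/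
def Lcomp (ζ11 ζ22 ζ33 ζ12 ζ13 ζ23 ξ11 ξ22 ξ33 ξ12 ξ13 ξ23 : ℝ)
    (a b i : Fin 4) (x : Fin 4 → ℝ) : ℝ :=
  letI h : (Fin 4 → ℝ) → Matrix (Fin 4) (Fin 4) ℝ :=
    hfull ζ11 ζ22 ζ33 ζ12 ζ13 ζ23 ξ11 ξ22 ξ33 ξ12 ξ13 ξ23
  pd i (fun y => h y a b + y a * ∑ j, pd j (fun z => h z b j) y) x +
    (if i = b then (1 : ℝ) else 0) * ∑ j, pd j (fun z => h z j a) x +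
    pd a (fun y => h y i b) x -
    (if i = a then (1 : ℝ) else 0) * ∑ j, pd j (fun z => h z j b) x -
    pd b (fun y => h y i a) x

open scoped ContDiff

theorem pd_congr {f g : (Fin 4 → ℝ) → ℝ} (h : ∀ y, y ≠ 0 → f y = g y) (i : Fin 4)
    (x : Fin 4 → ℝ) (hx : x ≠ 0) : pd i f x = pd i g x := by
  have : f =ᶠ[nhds x] g := by
    filter_upwards [isOpen_ne.mem_nhds hx] with y hy using h y hy
  unfold pd
  rw [this.fderiv_eq]

theorem pd_add {f g : (Fin 4 → ℝ) → ℝ} {x : Fin 4 → ℝ} (i : Fin 4)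
    (hf : DifferentiableAt ℝ f x) (hg : DifferentiableAt ℝ g x) :
    pd i (fun y => f y + g y) x = pd i f x + pd i g x := by
  unfold pd
  rw [fderiv_fun_add hf hg]; rfl

theorem pd_mul {f g : (Fin 4 → ℝ) → ℝ} {x : Fin 4 → ℝ} (i : Fin 4)
    (hf : DifferentiableAt ℝ f x) (hg : DifferentiableAt ℝ g x) :
    pd i (fun y => f y * g y) x = pd i f x * g x + f x * pd i g x := by
  unfold pd
  rw [fderiv_fun_mul hf hg]; simp; ring

theorem pd_const_mul {f : (Fin 4 → ℝ) → ℝ} {x : Fin 4 → ℝ} (i : Fin 4) (c : ℝ)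
    (hf : DifferentiableAt ℝ f x) :
    pd i (fun y => c * f y) x = c * pd i f x := by
  unfold pd
  rw [fderiv_const_mul hf]; simp

theorem pd_sum {f : Fin 4 → (Fin 4 → ℝ) → ℝ} {x : Fin 4 → ℝ} (i : Fin 4)
    (hf : ∀ k, DifferentiableAt ℝ (f k) x) :
    pd i (fun y => ∑ k, f k y) x = ∑ k, pd i (f k) x := by
  unfold pd
  rw [fderiv_fun_sum (fun k _ => hf k)]; simp

theorem pd_coord (i k : Fin 4) (x : Fin 4 → ℝ) :
    pd i (fun y => y k) x = if k = i then 1 else 0 := by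
  unfold pd
  have : HasFDerivAt (fun y : Fin 4 → ℝ => y k)
    (ContinuousLinearMap.proj (R := ℝ) (φ := fun _ : Fin 4 => ℝ) k) x :=
      (ContinuousLinearMap.proj (R := ℝ) (φ := fun _ : Fin 4 => ℝ) k).hasFDerivAt
  rw [this.fderiv]
  simp [Pi.single_apply]

/-- squared norm -/
def sq4 (y : Fin 4 → ℝ) : ℝ := ∑ m, y m ^ 2

theorem sq4_ne {x : Fin 4 → ℝ} (hx : x ≠ 0) : sq4 x ≠ 0 := by
  intro h
  apply hx
  unfold sq4 at h
  rw [Finset.sum_eq_zero_iff_of_nonneg (fun m _ => sq_nonneg _)] at h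
  funext m
  have := h m (Finset.mem_univ m)
  simpa using this

theorem sq4_smooth : ContDiff ℝ ∞ sq4 := by
  unfold sq4; fun_prop

theorem pd_sq4 (i : Fin 4) (x : Fin 4 → ℝ) : pd i sq4 x = 2 * x i := by
  unfold sq4
  rw [pd_sum i (fun k => by fun_prop)]
  have : ∀ k, pd i (fun y : Fin 4 → ℝ => y k ^ 2) x = if k = i then 2 * x k else 0 := by
    intro k
    simp only [pow_two]
    rw [pd_mul i (by fun_prop) (by fun_prop), pd_coord]
    split_ifs <;> ring
  simp [this]

structure Good (d : ℝ) (u : (Fin 4 → ℝ) → ℝ) : Prop where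
  smooth : ∀ x, x ≠ 0 → ContDiffAt ℝ ∞ u x
  harm : ∀ x, x ≠ 0 → ∑ l, pd l (pd l u) x = 0
  euler : ∀ x, x ≠ 0 → ∑ l, x l * pd l u x = d * u x

theorem smooth_pd {u : (Fin 4 → ℝ) → ℝ} {x : Fin 4 → ℝ} (h : ContDiffAt ℝ ∞ u x) (i : Fin 4) :
    ContDiffAt ℝ ∞ (pd i u) x := by
  unfold pd
  exact (h.fderiv_right (m := ∞) (by simp)).clm_apply contDiffAt_const

theorem diff_of {u : (Fin 4 → ℝ) → ℝ} {x : Fin 4 → ℝ} (h : ContDiffAt ℝ ∞ u x) :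
    DifferentiableAt ℝ u x := h.differentiableAt (by simp)

theorem pd_comm {u : (Fin 4 → ℝ) → ℝ} {x : Fin 4 → ℝ} (h : ContDiffAt ℝ ∞ u x) (i j : Fin 4) :
    pd i (pd j u) x = pd j (pd i u) x := by
  have hd : DifferentiableAt ℝ (fderiv ℝ u) x :=
    (h.fderiv_right (m := ∞) (by simp)).differentiableAt (by simp)
  have key : ∀ i j : Fin 4, pd i (pd j u) x
      = fderiv ℝ (fderiv ℝ u) x (Pi.single i 1) (Pi.single j 1) := by
    intro i j
    unfold pd
    rw [fderiv_clm_apply hd (by fun_prop)]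
    simp
  rw [key, key]
  exact (h.isSymmSndFDerivAt (by simp only [minSmoothness_of_isRCLikeNormedField]; exact WithTop.coe_le_coe.2 (le_top : (2 : ℕ∞) ≤ ⊤))).eq _ _

theorem Good.congr {d : ℝ} {u v : (Fin 4 → ℝ) → ℝ} (hu : Good d u)
    (h : ∀ y, y ≠ 0 → v y = u y) : Good d v where
  smooth x hx := (hu.smooth x hx).congr_of_eventuallyEq (by
    filter_upwards [isOpen_ne.mem_nhds hx] with y hy using h y hy)
  harm x hx := by
    rw [← hu.harm x hx]
    exact Finset.sum_congr rfl fun l _ => pd_congr (fun y hy => pd_congr h l y hy) l x hx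
  euler x hx := by
    rw [h x hx, ← hu.euler x hx]
    exact Finset.sum_congr rfl fun l _ => by rw [pd_congr h l x hx]

theorem Good.add {d : ℝ} {u v : (Fin 4 → ℝ) → ℝ} (hu : Good d u) (hv : Good d v) :
    Good d (fun y => u y + v y) where
  smooth x hx := (hu.smooth x hx).add (hv.smooth x hx)
  harm x hx := by
    have : ∀ l, pd l (pd l (fun y => u y + v y)) x = pd l (pd l u) x + pd l (pd l v) x := by
      intro l
      rw [pd_congr (fun y hy => pd_add l (diff_of (hu.smooth y hy)) (diff_of (hv.smooth y hy))) l x hx]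
      exact pd_add l (diff_of (smooth_pd (hu.smooth x hx) l)) (diff_of (smooth_pd (hv.smooth x hx) l))
    simp only [this, Finset.sum_add_distrib, hu.harm x hx, hv.harm x hx, add_zero]
  euler x hx := by
    simp only [pd_add _ (diff_of (hu.smooth x hx)) (diff_of (hv.smooth x hx)), mul_add,
      Finset.sum_add_distrib, hu.euler x hx, hv.euler x hx]

theorem Good.smul {d : ℝ} {u : (Fin 4 → ℝ) → ℝ} (c : ℝ) (hu : Good d u) :
    Good d (fun y => c * u y) where
  smooth x hx := contDiffAt_const.mul (hu.smooth x hx)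
  harm x hx := by
    have : ∀ l, pd l (pd l (fun y => c * u y)) x = c * pd l (pd l u) x := by
      intro l
      rw [pd_congr (fun y hy => pd_const_mul l c (diff_of (hu.smooth y hy))) l x hx]
      exact pd_const_mul l c (diff_of (smooth_pd (hu.smooth x hx) l))
    simp only [this, ← Finset.mul_sum, hu.harm x hx, mul_zero]
  euler x hx := by
    simp only [pd_const_mul _ c (diff_of (hu.smooth x hx))]
    rw [show d * (c * u x) = c * (d * u x) by ring, ← hu.euler x hx, Finset.mul_sum]
    exact Finset.sum_congr rfl fun l _ => by ring

theorem pd_zero (i : Fin 4) (x : Fin 4 → ℝ) : pd i (fun _ => (0:ℝ)) x = 0 := by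
  simp [pd]

theorem Good.pd {d : ℝ} {u : (Fin 4 → ℝ) → ℝ} (hu : Good d u) (i : Fin 4) :
    Good (d - 1) (pd i u) where
  smooth x hx := smooth_pd (hu.smooth x hx) i
  harm x hx := by
    have h1 : ∀ l, _root_.pd l (_root_.pd l (_root_.pd i u)) x
        = _root_.pd i (_root_.pd l (_root_.pd l u)) x := by
      intro l
      rw [pd_congr (fun y hy => pd_comm (hu.smooth y hy) l i) l x hx]
      exact pd_comm (smooth_pd (hu.smooth x hx) l) l i
    simp only [h1]
    rw [← pd_sum i (fun k => diff_of (smooth_pd (smooth_pd (hu.smooth x hx) k) k)),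
      pd_congr hu.harm i x hx, pd_zero]
  euler x hx := by
    have h := pd_congr hu.euler i x hx
    have hd := fun k => diff_of (smooth_pd (hu.smooth x hx) k)
    rw [pd_sum i (fun k => DifferentiableAt.fun_mul (by fun_prop) (hd k)),
      pd_const_mul i d (diff_of (hu.smooth x hx))] at h
    have h2 : ∀ k, _root_.pd i (fun y => y k * _root_.pd k u y) x
        = (if k = i then _root_.pd k u x else 0) + x k * _root_.pd k (_root_.pd i u) x := by
      intro k
      rw [pd_mul i (by fun_prop) (hd k), pd_coord, pd_comm (hu.smooth x hx) i k]
      split_ifs <;> ring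
    simp only [h2, Finset.sum_add_distrib, Finset.sum_ite_eq', Finset.mem_univ, if_true] at h
    linarith

theorem Good.final {u : (Fin 4 → ℝ) → ℝ} (hu : Good (-5) u) (x : Fin 4 → ℝ) (hx : x ≠ 0) :
    ∑ l, _root_.pd l (_root_.pd l (fun y => (∑ m, y m ^ 2) * u y / 12)) x = - u x := by
  have hs : ∀ y, DifferentiableAt ℝ sq4 y := fun y => diff_of sq4_smooth.contDiffAt
  have h1 : ∀ l, ∀ y, y ≠ 0 → _root_.pd l (fun y => (∑ m, y m ^ 2) * u y / 12) y
      = (1/12) * ((2 * y l) * u y + sq4 y * _root_.pd l u y) := by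
    intro l y hy
    have hy' := diff_of (hu.smooth y hy)
    have : (fun y => (∑ m, y m ^ 2) * u y / 12) = fun y => (1/12) * (sq4 y * u y) := by
      funext z; unfold sq4; ring
    rw [this, pd_const_mul l _ ((hs y).fun_mul hy'), pd_mul l (hs y) hy', pd_sq4]
  have h2 : ∀ l, _root_.pd l (_root_.pd l (fun y => (∑ m, y m ^ 2) * u y / 12)) x
      = (1/12) * (2 * u x + 4 * (x l * _root_.pd l u x) + sq4 x * _root_.pd l (_root_.pd l u) x) := by
    intro l
    have hx' := diff_of (hu.smooth x hx)
    have hx'' := diff_of (smooth_pd (hu.smooth x hx) l)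
    have hc : DifferentiableAt ℝ (fun y : Fin 4 → ℝ => 2 * y l) x := by fun_prop
    rw [pd_congr (h1 l) l x hx,
      pd_const_mul l _ ((hc.fun_mul hx').fun_add ((hs x).fun_mul hx'')),
      pd_add l (hc.fun_mul hx') ((hs x).fun_mul hx''), pd_mul l hc hx', pd_mul l (hs x) hx'',
      pd_sq4, pd_const_mul l 2 (by fun_prop), pd_coord]
    simp; ring
  simp only [h2, ← Finset.mul_sum, Finset.sum_add_distrib, hu.euler x hx, hu.harm x hx]
  simp; ring

/-- quadratic form -/
def qf (M : Fin 4 → Fin 4 → ℝ) (y : Fin 4 → ℝ) : ℝ := ∑ k, ∑ l, M k l * (y k * y l)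

theorem qf_smooth (M : Fin 4 → Fin 4 → ℝ) : ContDiff ℝ ∞ (qf M) := by
  unfold qf; fun_prop

theorem pd_qf (M : Fin 4 → Fin 4 → ℝ) (i : Fin 4) (x : Fin 4 → ℝ) :
    pd i (qf M) x = ∑ k, (M i k + M k i) * x k := by
  unfold qf
  rw [pd_sum i (fun k => by fun_prop)]
  have h : ∀ k, pd i (fun y : Fin 4 → ℝ => ∑ l, M k l * (y k * y l)) x
      = ∑ l, M k l * ((if k = i then x l else 0) + (if l = i then x k else 0)) := by
    intro k
    rw [pd_sum i (fun k => by fun_prop)]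
    refine Finset.sum_congr rfl fun l _ => ?_
    rw [pd_const_mul i _ (by fun_prop), pd_mul i (by fun_prop) (by fun_prop), pd_coord, pd_coord]
    simp
  simp only [h, mul_add, add_mul, Finset.sum_add_distrib]
  simp

theorem pd_pd_qf (M : Fin 4 → Fin 4 → ℝ) (i : Fin 4) (x : Fin 4 → ℝ) :
    pd i (pd i (qf M)) x = 2 * M i i := by
  rw [show pd i (qf M) = fun x => ∑ k, (M i k + M k i) * x k from funext (pd_qf M i),
    pd_sum i (fun k => by fun_prop)]
  have : ∀ k, pd i (fun y : Fin 4 → ℝ => (M i k + M k i) * y k) x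
      = if k = i then M i k + M k i else 0 := by
    intro k
    rw [pd_const_mul i _ (by fun_prop), pd_coord]; simp
  simp [this]; ring

theorem inv_smooth (n : ℕ) {x : Fin 4 → ℝ} (hx : x ≠ 0) :
    ContDiffAt ℝ ∞ (fun y => (sq4 y)⁻¹ ^ n) x :=
  (sq4_smooth.contDiffAt.inv (sq4_ne hx)).pow n

theorem pd_inv (n : ℕ) (i : Fin 4) {x : Fin 4 → ℝ} (hx : x ≠ 0) :
    pd i (fun y => (sq4 y)⁻¹ ^ (n+1)) x = -(2 * (n+1)) * x i * (sq4 x)⁻¹ ^ (n+2) := by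
  have h0 : HasFDerivAt sq4 (fderiv ℝ sq4 x) x := (diff_of sq4_smooth.contDiffAt).hasFDerivAt
  have h1 : HasDerivAt (fun t : ℝ => t⁻¹ ^ (n+1)) (((n+1 : ℕ):ℝ) * (sq4 x)⁻¹ ^ n * (-(sq4 x ^ 2)⁻¹))
      (sq4 x) := by
    simpa using (hasDerivAt_inv (sq4_ne hx)).fun_pow (n+1)
  have h2 := h1.comp_hasFDerivAt x h0
  have h3 := pd_sq4 i x
  unfold pd at h3 ⊢
  have h4 : fderiv ℝ (fun y => (sq4 y)⁻¹ ^ (n+1)) x = _ := h2.fderiv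
  rw [h4]
  simp only [smul_apply, smul_eq_mul]
  rw [h3]
  push_cast
  rw [← inv_pow]
  ring

/-- the Kelvin-type function -/
def kel (M : Fin 4 → Fin 4 → ℝ) (y : Fin 4 → ℝ) : ℝ := (sq4 y)⁻¹ ^ 3 * qf M y

theorem pd_kel (M : Fin 4 → Fin 4 → ℝ) (i : Fin 4) (x : Fin 4 → ℝ) (hx : x ≠ 0) :
    pd i (kel M) x = (sq4 x)⁻¹ ^ 3 * pd i (qf M) x + (-6) * ((sq4 x)⁻¹ ^ 4 * (x i * qf M x)) := by
  unfold kel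
  rw [pd_mul i (diff_of (inv_smooth 3 hx)) (diff_of (qf_smooth M).contDiffAt), pd_inv 2 i hx]
  push_cast; ring

theorem euler_qf (M : Fin 4 → Fin 4 → ℝ) (x : Fin 4 → ℝ) :
    ∑ l, x l * pd l (qf M) x = 2 * qf M x := by
  simp only [pd_qf]
  unfold qf
  simp only [Fin.sum_univ_four]
  ring

theorem good_kel (M : Fin 4 → Fin 4 → ℝ) (hM : ∑ k, M k k = 0) : Good (-4) (kel M) where
  smooth x hx := (inv_smooth 3 hx).mul (qf_smooth M).contDiffAt
  harm x hx := by
    have hq : ∀ y, ContDiffAt ℝ ∞ (qf M) y := fun y => (qf_smooth M).contDiffAt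
    have h : ∀ l, pd l (pd l (kel M)) x = (sq4 x)⁻¹ ^ 3 * (2 * M l l)
        - 12 * (sq4 x)⁻¹ ^ 4 * (x l * pd l (qf M) x)
        - 6 * (sq4 x)⁻¹ ^ 4 * qf M x + 48 * (sq4 x)⁻¹ ^ 5 * qf M x * x l ^ 2 := by
      intro l
      have d1 := diff_of (inv_smooth 3 hx)
      have d2 := diff_of (inv_smooth 4 hx)
      have d3 := diff_of (smooth_pd (hq x) l)
      have d4 : DifferentiableAt ℝ (fun y : Fin 4 → ℝ => y l) x := by fun_prop
      have d5 := diff_of (hq x)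
      rw [pd_congr (pd_kel M l) l x hx,
        pd_add l (d1.fun_mul d3) (DifferentiableAt.const_mul (d2.fun_mul (d4.fun_mul d5)) _),
        pd_const_mul l _ (d2.fun_mul (d4.fun_mul d5)), pd_mul l d1 d3,
        pd_mul l d2 (d4.fun_mul d5), pd_mul l d4 d5, pd_coord, pd_inv 2 l hx, pd_inv 3 l hx,
        pd_pd_qf]
      push_cast; simp only [if_true]; ring
    simp only [h, Finset.sum_add_distrib, Finset.sum_sub_distrib, ← Finset.mul_sum, euler_qf, hM]
    rw [show ∑ i, x i ^ 2 = sq4 x from rfl]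
    have := sq4_ne hx
    simp
    field_simp
    ring
  euler x hx := by
    simp only [pd_kel M _ x hx]
    have : ∀ l, x l * ((sq4 x)⁻¹ ^ 3 * pd l (qf M) x + (-6) * ((sq4 x)⁻¹ ^ 4 * (x l * qf M x)))
      = (sq4 x)⁻¹ ^ 3 * (x l * pd l (qf M) x) + (-6 * (sq4 x)⁻¹ ^ 4 * qf M x) * x l ^ 2 := by
      intro l; ring
    simp only [this, Finset.sum_add_distrib, ← Finset.mul_sum, euler_qf]
    rw [show ∑ i, x i ^ 2 = sq4 x from rfl]
    have := sq4_ne hx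
    unfold kel
    field_simp
    ring

/-- coefficients of the bracket in `h⁺` -/
def Mp (ζ11 ζ22 ζ33 ζ12 ζ13 ζ23 : ℝ) (a b k l : Fin 4) : ℝ :=
  -(2/3) * (ζ11 * (2 * (I1 k a * I1 l b) - I2 k a * I2 l b - I3 k a * I3 l b) +
   ζ22 * (2 * (I2 k a * I2 l b) - I1 k a * I1 l b - I3 k a * I3 l b) +
   ζ33 * (2 * (I3 k a * I3 l b) - I1 k a * I1 l b - I2 k a * I2 l b) +
   ζ12 * (I1 k a * I2 l b + I2 k a * I1 l b) +
   ζ13 * (I1 k a * I3 l b + I3 k a * I1 l b) +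
   ζ23 * (I2 k a * I3 l b + I3 k a * I2 l b))

/-- diagonal of the reflection -/
def rd (a : Fin 4) : ℝ := (![1, -1, -1, -1] : Fin 4 → ℝ) a

/-- coefficients of `h` -/
def Mh (ζ11 ζ22 ζ33 ζ12 ζ13 ζ23 ξ11 ξ22 ξ33 ξ12 ξ13 ξ23 : ℝ) (a b k l : Fin 4) : ℝ :=
  Mp ζ11 ζ22 ζ33 ζ12 ζ13 ζ23 a b k l
    + rd a * rd b * rd k * rd l * Mp ξ11 ξ22 ξ33 ξ12 ξ13 ξ23 a b k l

theorem hplus_eq (ζ11 ζ22 ζ33 ζ12 ζ13 ζ23 : ℝ) (a b : Fin 4) (x : Fin 4 → ℝ) :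
    hplus ζ11 ζ22 ζ33 ζ12 ζ13 ζ23 x a b = kel (Mp ζ11 ζ22 ζ33 ζ12 ζ13 ζ23 a b) x := by
  have hA : ∀ J K : Matrix (Fin 4) (Fin 4) ℝ, Amat J K x a b
      = (∑ k, J k a * x k) * (∑ l, K l b * x l) := by
    intro J K; rfl
  unfold hplus kel qf Mp
  simp only [Matrix.smul_apply, Matrix.add_apply, Matrix.sub_apply, hA, smul_eq_mul]
  rw [show ∑ i, x i ^ 2 = sq4 x from rfl]
  have : -(2 / (3 * sq4 x ^ 3)) = (sq4 x)⁻¹ ^ 3 * (-(2/3)) := by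
    rw [inv_pow, div_mul_eq_div_div, div_eq_mul_inv (2/3)]; ring
  rw [this, mul_assoc]
  congr 1
  simp only [Fin.sum_univ_four]
  ring

theorem hfull_eq (ζ11 ζ22 ζ33 ζ12 ζ13 ζ23 ξ11 ξ22 ξ33 ξ12 ξ13 ξ23 : ℝ) (a b : Fin 4)
    (x : Fin 4 → ℝ) :
    hfull ζ11 ζ22 ζ33 ζ12 ζ13 ζ23 ξ11 ξ22 ξ33 ξ12 ξ13 ξ23 x a b
      = kel (Mh ζ11 ζ22 ζ33 ζ12 ζ13 ζ23 ξ11 ξ22 ξ33 ξ12 ξ13 ξ23 a b) x := by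
  have hR : Rrefl = Matrix.diagonal rd := rfl
  have hv : Matrix.mulVec Rrefl x = fun k => rd k * x k := by
    funext k; rw [hR, Matrix.mulVec_diagonal]
  have hr : ∀ k, rd k ^ 2 = 1 := by
    intro k; fin_cases k <;> simp [rd]
  have hs : sq4 (fun k => rd k * x k) = sq4 x := by
    unfold sq4; simp only [mul_pow, hr, one_mul]
  unfold hfull hminus
  rw [Matrix.add_apply, hv, hR, Matrix.mul_diagonal, Matrix.diagonal_mul, hplus_eq, hplus_eq]
  unfold kel
  rw [hs]
  unfold qf Mh
  rw [mul_comm (rd a), mul_assoc, mul_assoc, ← mul_add]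
  congr 1
  simp only [Fin.sum_univ_four]
  ring

theorem I3_eq : I3 = !![0, 0, 0, -1; 0, 0, -1, 0; 0, 1, 0, 0; 1, 0, 0, 0] := by
  unfold I3 I1 I2
  ext i j
  fin_cases i <;> fin_cases j <;> simp [Matrix.mul_apply, Fin.sum_univ_four]

theorem Mh_symm (ζ11 ζ22 ζ33 ζ12 ζ13 ζ23 ξ11 ξ22 ξ33 ξ12 ξ13 ξ23 : ℝ) (a b : Fin 4)
    (x : Fin 4 → ℝ) :
    kel (Mh ζ11 ζ22 ζ33 ζ12 ζ13 ζ23 ξ11 ξ22 ξ33 ξ12 ξ13 ξ23 a b) x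
      = kel (Mh ζ11 ζ22 ζ33 ζ12 ζ13 ζ23 ξ11 ξ22 ξ33 ξ12 ξ13 ξ23 b a) x := by
  unfold kel qf
  congr 1
  rw [Finset.sum_comm]
  refine Finset.sum_congr rfl fun k _ => Finset.sum_congr rfl fun l _ => ?_
  unfold Mh Mp
  ring

theorem Mp_trace (ζ11 ζ22 ζ33 ζ12 ζ13 ζ23 : ℝ) (a b : Fin 4) :
    ∑ k, Mp ζ11 ζ22 ζ33 ζ12 ζ13 ζ23 a b k k = 0 := by
  unfold Mp
  rw [I3_eq]
  simp only [Fin.sum_univ_four]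
  fin_cases a <;> fin_cases b <;> simp [I1, I2] <;> ring

theorem Mh_trace (ζ11 ζ22 ζ33 ζ12 ζ13 ζ23 ξ11 ξ22 ξ33 ξ12 ξ13 ξ23 : ℝ) (a b : Fin 4) :
    ∑ k, Mh ζ11 ζ22 ζ33 ζ12 ζ13 ζ23 ξ11 ξ22 ξ33 ξ12 ξ13 ξ23 a b k k = 0 := by
  have hr : ∀ k, rd k * rd k = 1 := by
    intro k; fin_cases k <;> simp [rd]
  have : ∀ k, rd a * rd b * rd k * rd k = rd a * rd b := by
    intro k; rw [mul_assoc, hr, mul_one]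
  unfold Mh
  simp only [this, Finset.sum_add_distrib, ← Finset.mul_sum, Mp_trace, mul_zero, add_zero]

theorem Mp_div (ζ11 ζ22 ζ33 ζ12 ζ13 ζ23 : ℝ) (b k : Fin 4) :
    ∑ j, (Mp ζ11 ζ22 ζ33 ζ12 ζ13 ζ23 b j j k + Mp ζ11 ζ22 ζ33 ζ12 ζ13 ζ23 b j k j) = 0 := by
  unfold Mp
  rw [I3_eq]
  simp only [Fin.sum_univ_four]
  fin_cases b <;> fin_cases k <;> simp [I1, I2] <;> ring

theorem Mp_rad (ζ11 ζ22 ζ33 ζ12 ζ13 ζ23 : ℝ) (b : Fin 4) (x : Fin 4 → ℝ) :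
    ∑ j, x j * qf (Mp ζ11 ζ22 ζ33 ζ12 ζ13 ζ23 b j) x = 0 := by
  have hJ : ∀ J : Matrix (Fin 4) (Fin 4) ℝ, (J = I1 ∨ J = I2 ∨ J = I3) →
      ∑ j, ∑ l, x j * (J l j * x l) = 0 := by
    rw [I3_eq]
    rintro J (rfl | rfl | rfl) <;> simp [Fin.sum_univ_four, I1, I2] <;> ring
  have h1 := hJ I1 (by simp)
  have h2 := hJ I2 (by simp)
  have h3 := hJ I3 (by simp)
  simp only [Fin.sum_univ_four] at h1 h2 h3
  unfold qf Mp
  simp only [Fin.sum_univ_four]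
  linear_combination
    (-(2/3) * ((2*ζ11 - ζ22 - ζ33) * (I1 0 b * x 0 + I1 1 b * x 1 + I1 2 b * x 2 + I1 3 b * x 3)
      + ζ12 * (I2 0 b * x 0 + I2 1 b * x 1 + I2 2 b * x 2 + I2 3 b * x 3)
      + ζ13 * (I3 0 b * x 0 + I3 1 b * x 1 + I3 2 b * x 2 + I3 3 b * x 3))) * h1
    + (-(2/3) * ((2*ζ22 - ζ11 - ζ33) * (I2 0 b * x 0 + I2 1 b * x 1 + I2 2 b * x 2 + I2 3 b * x 3)
      + ζ12 * (I1 0 b * x 0 + I1 1 b * x 1 + I1 2 b * x 2 + I1 3 b * x 3)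
      + ζ23 * (I3 0 b * x 0 + I3 1 b * x 1 + I3 2 b * x 2 + I3 3 b * x 3))) * h2
    + (-(2/3) * ((2*ζ33 - ζ11 - ζ22) * (I3 0 b * x 0 + I3 1 b * x 1 + I3 2 b * x 2 + I3 3 b * x 3)
      + ζ13 * (I1 0 b * x 0 + I1 1 b * x 1 + I1 2 b * x 2 + I1 3 b * x 3)
      + ζ23 * (I2 0 b * x 0 + I2 1 b * x 1 + I2 2 b * x 2 + I2 3 b * x 3))) * h3

theorem Mh_div (ζ11 ζ22 ζ33 ζ12 ζ13 ζ23 ξ11 ξ22 ξ33 ξ12 ξ13 ξ23 : ℝ) (b : Fin 4)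
    (x : Fin 4 → ℝ) (hx : x ≠ 0) :
    ∑ j, pd j (kel (Mh ζ11 ζ22 ζ33 ζ12 ζ13 ζ23 ξ11 ξ22 ξ33 ξ12 ξ13 ξ23 b j)) x = 0 := by
  have hr : ∀ k, rd k * rd k = 1 := by
    intro k; fin_cases k <;> simp [rd]
  have e1 : ∑ j, pd j (qf (Mh ζ11 ζ22 ζ33 ζ12 ζ13 ζ23 ξ11 ξ22 ξ33 ξ12 ξ13 ξ23 b j)) x = 0 := by
    simp only [pd_qf]
    rw [Finset.sum_comm]
    refine Finset.sum_eq_zero fun k _ => ?_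
    rw [← Finset.sum_mul]
    have : ∀ j, (Mh ζ11 ζ22 ζ33 ζ12 ζ13 ζ23 ξ11 ξ22 ξ33 ξ12 ξ13 ξ23 b j j k
        + Mh ζ11 ζ22 ζ33 ζ12 ζ13 ζ23 ξ11 ξ22 ξ33 ξ12 ξ13 ξ23 b j k j)
        = (Mp ζ11 ζ22 ζ33 ζ12 ζ13 ζ23 b j j k + Mp ζ11 ζ22 ζ33 ζ12 ζ13 ζ23 b j k j)
        + (rd b * rd k) *
          (Mp ξ11 ξ22 ξ33 ξ12 ξ13 ξ23 b j j k + Mp ξ11 ξ22 ξ33 ξ12 ξ13 ξ23 b j k j) := by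
      intro j
      unfold Mh
      linear_combination (rd b * rd k * (Mp ξ11 ξ22 ξ33 ξ12 ξ13 ξ23 b j j k
        + Mp ξ11 ξ22 ξ33 ξ12 ξ13 ξ23 b j k j)) * hr j
    simp only [this, Finset.sum_add_distrib (f := fun j => _ + _), ← Finset.mul_sum, Mp_div]
    simp
  have e2 : ∑ j, x j * qf (Mh ζ11 ζ22 ζ33 ζ12 ζ13 ζ23 ξ11 ξ22 ξ33 ξ12 ξ13 ξ23 b j) x = 0 := by
    have : ∀ j, x j * qf (Mh ζ11 ζ22 ζ33 ζ12 ζ13 ζ23 ξ11 ξ22 ξ33 ξ12 ξ13 ξ23 b j) x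
        = x j * qf (Mp ζ11 ζ22 ζ33 ζ12 ζ13 ζ23 b j) x
        + rd b * ((rd j * x j) * qf (Mp ξ11 ξ22 ξ33 ξ12 ξ13 ξ23 b j) (fun k => rd k * x k)) := by
      intro j
      unfold qf Mh
      simp only [Fin.sum_univ_four]
      ring
    simp only [this, Finset.sum_add_distrib, ← Finset.mul_sum, Mp_rad]
    simp
  simp only [pd_kel _ _ x hx, Finset.sum_add_distrib, ← Finset.mul_sum, e1, e2]
  simp

/-- The corrector `μ̃(x) = |x|²·(L_{ab})_i(x)/12` satisfies `∑ₗ ∂ₗ² μ̃ = −(L_{ab})_i` on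
`ℝ⁴ ∖ {0}`; i.e. for the geometer's Laplacian `Δ = −∑ₗ ∂ₗ²`, `Δ μ̃ = (L_{ab})_i`. -/
theorem laplacian_muTilde
    (ζ11 ζ22 ζ33 ζ12 ζ13 ζ23 ξ11 ξ22 ξ33 ξ12 ξ13 ξ23 : ℝ) (a b i : Fin 4)
    (x : Fin 4 → ℝ) (hx : x ≠ 0) :
    ∑ l, pd l (pd l
        (fun y => (∑ m, y m ^ 2) *
          Lcomp ζ11 ζ22 ζ33 ζ12 ζ13 ζ23 ξ11 ξ22 ξ33 ξ12 ξ13 ξ23 a b i y / 12)) x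
      = -(Lcomp ζ11 ζ22 ζ33 ζ12 ζ13 ζ23 ξ11 ξ22 ξ33 ξ12 ξ13 ξ23 a b i x) := by
  have hK : ∀ c d : Fin 4, (fun y => hfull ζ11 ζ22 ζ33 ζ12 ζ13 ζ23 ξ11 ξ22 ξ33 ξ12 ξ13 ξ23 y c d)
      = kel (Mh ζ11 ζ22 ζ33 ζ12 ζ13 ζ23 ξ11 ξ22 ξ33 ξ12 ξ13 ξ23 c d) :=
    fun c d => funext fun y => hfull_eq _ _ _ _ _ _ _ _ _ _ _ _ c d y
  have hS : ∀ c d : Fin 4, kel (Mh ζ11 ζ22 ζ33 ζ12 ζ13 ζ23 ξ11 ξ22 ξ33 ξ12 ξ13 ξ23 c d)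
      = kel (Mh ζ11 ζ22 ζ33 ζ12 ζ13 ζ23 ξ11 ξ22 ξ33 ξ12 ξ13 ξ23 d c) :=
    fun c d => funext fun y => Mh_symm _ _ _ _ _ _ _ _ _ _ _ _ c d y
  have hG : ∀ c d : Fin 4, Good (-4) (kel (Mh ζ11 ζ22 ζ33 ζ12 ζ13 ζ23 ξ11 ξ22 ξ33 ξ12 ξ13 ξ23 c d)) :=
    fun c d => good_kel _ (Mh_trace _ _ _ _ _ _ _ _ _ _ _ _ c d)
  have hD : ∀ c : Fin 4, ∀ y, y ≠ 0 →
      ∑ j, pd j (fun z => hfull ζ11 ζ22 ζ33 ζ12 ζ13 ζ23 ξ11 ξ22 ξ33 ξ12 ξ13 ξ23 z c j) y = 0 := by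
    intro c y hy
    simp only [hK]
    exact Mh_div _ _ _ _ _ _ _ _ _ _ _ _ c y hy
  have hD2 : ∀ c : Fin 4, ∀ y, y ≠ 0 →
      ∑ j, pd j (fun z => hfull ζ11 ζ22 ζ33 ζ12 ζ13 ζ23 ξ11 ξ22 ξ33 ξ12 ξ13 ξ23 z j c) y = 0 := by
    intro c y hy
    simp only [hK, hS _ c]
    exact Mh_div _ _ _ _ _ _ _ _ _ _ _ _ c y hy
  have hgood := (((hG a b).pd i).add ((hG i b).pd a)).add (((hG i a).pd b).smul (-1))
  rw [show (-4 - 1 : ℝ) = -5 by norm_num] at hgood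
  have hL := hgood.congr
    (v := Lcomp ζ11 ζ22 ζ33 ζ12 ζ13 ζ23 ξ11 ξ22 ξ33 ξ12 ξ13 ξ23 a b i) (by
      intro y hy
      unfold Lcomp
      rw [hD2 a y hy, hD2 b y hy, hK i b, hK i a, ← hK a b]
      rw [pd_congr (g := fun y => hfull ζ11 ζ22 ζ33 ζ12 ζ13 ζ23 ξ11 ξ22 ξ33 ξ12 ξ13 ξ23 y a b)
        (fun z hz => by rw [hD b z hz]; ring) i y hy]
      ring)
  exact hL.final x hx
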